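/- There exist a C^∞ strictly positive function ρ : ℝ → ℝ, a C^∞ function k : ℝ → ℝ with k(s) ≥ 1 for all s, and a constant k* ≥ 1 such that for every k₀ ≥ k*, the nonadaptive feedback ū = −k₀ k(ζ)ζ globally stabilizes the augmented system: there exist a C¹ function V : ℝ^{p₁}×ℝ×ℝ^{p₂}×ℝ → ℝ and class-K∞ functions α̲, ᾱ with α̲(‖(η̄₁,x̄₁,η̄₂,ζ)‖) ≤ V(η̄₁,x̄₁,η̄₂,ζ) ≤ ᾱ(‖(η̄₁,x̄₁,η̄₂,ζ)‖) such that for all states (η̄₁,x̄₁,η̄₂,ζ) and all μ ∈ K, the derivative of V along the closed-loop vector field (with ū = −k₀k(ζ)ζ) is at most −‖η̄₁‖² − ‖η̄₂‖² − x̄₁² − ζ². Consequently, for every continuous μ : [0,∞) → K and every initial condition, every maximal solution of the closed-loop system is defined on [0,∞), bounded, and converges to the origin as t → ∞. -/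

import Mathlib

open Matrix Filter

/-- A real square matrix is Hurwitz if every eigenvalue of it (over `ℂ`) has negative
real part. -/
def IsHurwitz {q : ℕ} (M : Matrix (Fin q) (Fin q) ℝ) : Prop :=
  ∀ z ∈ spectrum ℂ (M.map (algebraMap ℝ ℂ)), z.re < 0

/-- A function `α : [0,∞) → [0,∞)` is of class `K∞`: continuous, strictly increasing,
`α(0) = 0`, and unbounded. (Stated for `α : ℝ → ℝ` on `[0,∞)`.) -/
def IsClassKInfty (α : ℝ → ℝ) : Prop :=
  ContinuousOn α (Set.Ici 0) ∧ StrictMonoOn α (Set.Ici 0) ∧ α 0 = 0 ∧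
    (∀ s ∈ Set.Ici (0 : ℝ), 0 ≤ α s) ∧ Filter.Tendsto α Filter.atTop Filter.atTop

section Hurwitz

attribute [local instance] Matrix.linftyOpNormedRing Matrix.linftyOpNormedAlgebra

/-- In a complex Banach algebra, powers of an element whose spectrum lies in the open unit disc
tend to zero. -/
theorem tendsto_pow_zero_of_spectrum_lt_one {A : Type*} [NormedRing A] [NormedAlgebra ℂ A]
    [CompleteSpace A] (a : A) (h : ∀ z ∈ spectrum ℂ a, ‖z‖ < 1) :
    Filter.Tendsto (fun n : ℕ => a ^ n) Filter.atTop (nhds 0) := by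
  rcases subsingleton_or_nontrivial A with hA | hA
  · exact (tendsto_const_nhds (x := (0 : A))).congr fun n => Subsingleton.elim _ _
  have hr : spectralRadius ℂ a < ((1 : NNReal) : ENNReal) :=
    spectrum.spectralRadius_lt_of_forall_lt a fun z hz => by
      exact_mod_cast h z hz
  obtain ⟨r, hr1, hr2⟩ := exists_between hr
  lift r to NNReal using (hr2.trans ENNReal.coe_lt_top).ne
  have hr2' : r < 1 := by exact_mod_cast hr2
  have hev := (spectrum.pow_nnnorm_pow_one_div_tendsto_nhds_spectralRadius a).eventually
    (gt_mem_nhds hr1)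
  refine squeeze_zero_norm' (a := fun n : ℕ => (r : ℝ) ^ n) ?_
    (tendsto_pow_atTop_nhds_zero_of_lt_one r.2 hr2')
  filter_upwards [hev, Filter.eventually_gt_atTop 0] with n hn hn0
  have h1 : ((‖a ^ n‖₊ : ENNReal) ^ (1 / n : ℝ)) ^ (n : ℝ) ≤ (r : ENNReal) ^ (n : ℝ) := by
    gcongr
  rw [← ENNReal.rpow_mul, one_div_mul_cancel (by positivity), ENNReal.rpow_one,
    ENNReal.rpow_natCast] at h1
  have h2 : ‖a ^ n‖₊ ≤ r ^ n := by exact_mod_cast h1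
  exact_mod_cast h2

/-- The Cayley transform of a Hurwitz matrix has powers tending to zero. -/
theorem IsHurwitz.exists_cayley {p : ℕ} {M : Matrix (Fin p) (Fin p) ℝ} (hM : IsHurwitz M) :
    ∃ R : Matrix (Fin p) (Fin p) ℝ, R * (1 - M) = 1 ∧ (1 - M) * R = 1 ∧
      Filter.Tendsto (fun n : ℕ => ((1 + M) * R) ^ n) Filter.atTop (nhds 0) := by
  let φ : Matrix (Fin p) (Fin p) ℝ →+* Matrix (Fin p) (Fin p) ℂ := (algebraMap ℝ ℂ).mapMatrix
  have hspec : ∀ z : ℂ, 0 ≤ z.re → IsUnit (algebraMap ℂ (Matrix (Fin p) (Fin p) ℂ) z - φ M) := by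
    intro z hz
    by_contra hcon
    exact absurd (hM z hcon) (not_lt.2 hz)
  have hdet : IsUnit (1 - M).det := by
    have h1 : IsUnit (φ (1 - M)) := by
      simpa using hspec 1 (by simp)
    rw [Matrix.isUnit_iff_isUnit_det] at h1
    have h2 : (φ (1 - M)).det = algebraMap ℝ ℂ (1 - M).det :=
      ((algebraMap ℝ ℂ).map_det (1 - M)).symm
    rw [h2] at h1
    rw [isUnit_iff_ne_zero] at h1 ⊢
    intro h0
    exact h1 (by rw [h0, map_zero])
  have hl := Matrix.nonsing_inv_mul _ hdet
  have hr := Matrix.mul_nonsing_inv _ hdet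
  refine ⟨(1 - M)⁻¹, hl, hr, ?_⟩
  set R := (1 - M)⁻¹ with hR
  have hφl : φ R * (1 - φ M) = 1 := by
    rw [← map_one φ, ← map_sub, ← map_mul, hl]
  have hφr : (1 - φ M) * φ R = 1 := by
    rw [← map_one φ, ← map_sub, ← map_mul, hr]
  have hC : ∀ z ∈ spectrum ℂ (φ ((1 + M) * R)), ‖z‖ < 1 := by
    intro z hz
    by_contra hz1
    rw [not_lt] at hz1
    apply hz
    have hfac : algebraMap ℂ (Matrix (Fin p) (Fin p) ℂ) z - φ ((1 + M) * R)
        = (algebraMap ℂ _ (z - 1) - algebraMap ℂ _ (z + 1) * φ M) * φ R := by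
      have h3 : algebraMap ℂ (Matrix (Fin p) (Fin p) ℂ) z
          = algebraMap ℂ (Matrix (Fin p) (Fin p) ℂ) z * ((1 - φ M) * φ R) := by
        rw [hφr, mul_one]
      rw [h3, map_mul, map_add, map_one, map_sub, map_add, map_one]
      noncomm_ring
    change IsUnit _
    rw [hfac]
    refine IsUnit.mul ?_ (IsUnit.of_mul_eq_one _ hφl)
    by_cases hz2 : z + 1 = 0
    · have hz3 : z = -1 := by linear_combination hz2
      rw [hz2, map_zero, zero_mul, sub_zero, hz3]
      exact (IsUnit.mk0 (-1 - 1 : ℂ) (by norm_num)).map _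
    · have h4 : algebraMap ℂ (Matrix (Fin p) (Fin p) ℂ) (z - 1) - algebraMap ℂ _ (z + 1) * φ M
          = algebraMap ℂ _ (z + 1) * (algebraMap ℂ _ ((z - 1) / (z + 1)) - φ M) := by
        rw [mul_sub, ← map_mul, mul_div_cancel₀ _ hz2]
      rw [h4]
      refine IsUnit.mul ((IsUnit.mk0 _ hz2).map _) (hspec _ ?_)
      rw [Complex.div_re, ← add_div]
      apply div_nonneg _ (Complex.normSq_nonneg _)
      have h5 : (1 : ℝ) ≤ Complex.normSq z := by
        rw [Complex.normSq_eq_norm_sq]; nlinarith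
      rw [Complex.normSq_apply] at h5
      simp only [Complex.sub_re, Complex.add_re, Complex.sub_im, Complex.add_im, Complex.one_re,
        Complex.one_im]
      nlinarith
  have hlim := tendsto_pow_zero_of_spectrum_lt_one _ hC
  refine tendsto_pi_nhds.2 fun i => tendsto_pi_nhds.2 fun j => ?_
  have hij := (Complex.continuous_re.tendsto _).comp
    (tendsto_pi_nhds.1 (tendsto_pi_nhds.1 hlim i) j)
  refine hij.congr fun n => ?_
  simp only [Function.comp_apply, ← map_pow]
  simp [φ]

/-- The bilinear form `∑_{n < N} ⟨Cⁿ u, Cⁿ v⟩`. -/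
noncomputable def powerSumForm {p : ℕ} (C : Matrix (Fin p) (Fin p) ℝ) (N : ℕ) :
    (Fin p → ℝ) →ₗ[ℝ] (Fin p → ℝ) →ₗ[ℝ] ℝ :=
  LinearMap.mk₂ ℝ (fun u v => ∑ n ∈ Finset.range N, (C ^ n *ᵥ u) ⬝ᵥ (C ^ n *ᵥ v))
    (fun u u' v => by simp [Matrix.mulVec_add, Finset.sum_add_distrib])
    (fun c u v => by simp [Matrix.mulVec_smul, Finset.mul_sum])
    (fun u v v' => by simp [Matrix.mulVec_add, Finset.sum_add_distrib])
    (fun c u v => by simp [Matrix.mulVec_smul, Finset.mul_sum])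

theorem powerSumForm_apply {p : ℕ} (C : Matrix (Fin p) (Fin p) ℝ) (N : ℕ) (u v : Fin p → ℝ) :
    powerSumForm C N u v = ∑ n ∈ Finset.range N, (C ^ n *ᵥ u) ⬝ᵥ (C ^ n *ᵥ v) := rfl

theorem powerSumForm_comm {p : ℕ} (C : Matrix (Fin p) (Fin p) ℝ) (N : ℕ) (u v : Fin p → ℝ) :
    powerSumForm C N u v = powerSumForm C N v u := by
  simp only [powerSumForm_apply, dotProduct_comm]

theorem powerSumForm_mulVec_self {p : ℕ} (C : Matrix (Fin p) (Fin p) ℝ) (N : ℕ) (u : Fin p → ℝ) :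
    powerSumForm C N (C *ᵥ u) (C *ᵥ u)
      = powerSumForm C N u u + (C ^ N *ᵥ u) ⬝ᵥ (C ^ N *ᵥ u) - u ⬝ᵥ u := by
  have h : powerSumForm C N (C *ᵥ u) (C *ᵥ u)
      = ∑ n ∈ Finset.range N, (C ^ (n + 1) *ᵥ u) ⬝ᵥ (C ^ (n + 1) *ᵥ u) := by
    simp only [powerSumForm_apply, Matrix.mulVec_mulVec, ← pow_succ]
  rw [h, powerSumForm_apply]
  have h1 := Finset.sum_range_succ (fun n => (C ^ n *ᵥ u) ⬝ᵥ (C ^ n *ᵥ u)) N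
  have h2 := Finset.sum_range_succ' (fun n => (C ^ n *ᵥ u) ⬝ᵥ (C ^ n *ᵥ u)) N
  simp only [pow_zero, Matrix.one_mulVec] at h2
  linarith

theorem norm_sq_le_dotProduct_self {p : ℕ} (u : Fin p → ℝ) : ‖u‖ ^ 2 ≤ u ⬝ᵥ u := by
  have h0 : 0 ≤ u ⬝ᵥ u := Finset.sum_nonneg fun i _ => mul_self_nonneg (u i)
  rw [← Real.le_sqrt (norm_nonneg _) h0, pi_norm_le_iff_of_nonneg (Real.sqrt_nonneg _)]
  intro i
  refine Real.le_sqrt_of_sq_le ?_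
  rw [Real.norm_eq_abs, sq_abs, sq]
  exact Finset.single_le_sum (f := fun i => u i * u i) (fun j _ => mul_self_nonneg (u j))
    (Finset.mem_univ i)

theorem dotProduct_self_le_norm_sq {p : ℕ} (u : Fin p → ℝ) : u ⬝ᵥ u ≤ p * ‖u‖ ^ 2 := by
  have h : ∀ i ∈ Finset.univ, u i * u i ≤ ‖u‖ ^ 2 := fun i _ => by
    have := norm_le_pi_norm u i
    rw [Real.norm_eq_abs] at this
    rw [← abs_mul_abs_self, sq]
    gcongr
  simpa [dotProduct] using Finset.sum_le_card_nsmul _ _ _ h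

/-- A Hurwitz matrix admits a quadratic Lyapunov form. -/
theorem IsHurwitz.exists_lyapunov_form {p : ℕ} {M : Matrix (Fin p) (Fin p) ℝ}
    (hM : IsHurwitz M) :
    ∃ B : (Fin p → ℝ) →L[ℝ] (Fin p → ℝ) →L[ℝ] ℝ, (∀ u v, B u v = B v u) ∧
      (∃ c > 0, ∀ u, c * ‖u‖ ^ 2 ≤ B u u) ∧ ∀ u, 2 * B u (M *ᵥ u) ≤ -‖u‖ ^ 2 := by
  obtain ⟨R, hl, hr, hlim⟩ := hM.exists_cayley
  set C := (1 + M) * R with hC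
  have hlim2 : Filter.Tendsto (fun n : ℕ => (p : ℝ) * ‖C ^ n‖ ^ 2) Filter.atTop (nhds 0) := by
    simpa using ((tendsto_norm_zero.comp hlim).pow 2).const_mul (p : ℝ)
  obtain ⟨N, hN, hN0⟩ := ((hlim2.eventually (gt_mem_nhds (show (0 : ℝ) < 1 / 2 by norm_num))).and
    (Filter.eventually_gt_atTop 0)).exists
  have hcontr : ∀ u, (C ^ N *ᵥ u) ⬝ᵥ (C ^ N *ᵥ u) ≤ 1 / 2 * (u ⬝ᵥ u) := fun u => by
    calc (C ^ N *ᵥ u) ⬝ᵥ (C ^ N *ᵥ u) ≤ p * ‖C ^ N *ᵥ u‖ ^ 2 := dotProduct_self_le_norm_sq _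
      _ ≤ p * (‖C ^ N‖ * ‖u‖) ^ 2 := by
        gcongr
        exact Matrix.linfty_opNorm_mulVec _ _
      _ = (p * ‖C ^ N‖ ^ 2) * ‖u‖ ^ 2 := by ring
      _ ≤ 1 / 2 * (u ⬝ᵥ u) := by
        gcongr
        exact norm_sq_le_dotProduct_self u
  let Q := powerSumForm C N
  have hQpos : ∀ u, ‖u‖ ^ 2 ≤ Q u u := fun u => by
    refine (norm_sq_le_dotProduct_self u).trans ?_
    have := Finset.single_le_sum (f := fun n => (C ^ n *ᵥ u) ⬝ᵥ (C ^ n *ᵥ u))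
      (fun n _ => Finset.sum_nonneg fun i _ => mul_self_nonneg _) (Finset.mem_range.2 hN0)
    simpa [Q, powerSumForm_apply] using this
  set m := ‖R‖ ^ 2 + 1 with hm
  have hm0 : 0 < m := by positivity
  have hdec : ∀ u, 2 * Q u (M *ᵥ u) ≤ -(1 / (4 * m)) * ‖u‖ ^ 2 := fun u => by
    set y := (1 - M) *ᵥ u with hy
    have hRy : u = R *ᵥ y := by rw [hy, Matrix.mulVec_mulVec, hl, Matrix.one_mulVec]
    have hCy : C *ᵥ y = u + M *ᵥ u := by
      rw [hC, ← Matrix.mulVec_mulVec, ← hRy, Matrix.add_mulVec, Matrix.one_mulVec]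
    have hy' : y = u - M *ᵥ u := by rw [hy, Matrix.sub_mulVec, Matrix.one_mulVec]
    have h1 := powerSumForm_mulVec_self C N y
    have h2 := hcontr y
    have h3 : Q (u + M *ᵥ u) (u + M *ᵥ u) - Q (u - M *ᵥ u) (u - M *ᵥ u) = 4 * Q u (M *ᵥ u) := by
      have h4 : Q (M *ᵥ u) u = Q u (M *ᵥ u) := powerSumForm_comm _ _ _ _
      simp only [map_add, map_sub, LinearMap.add_apply, LinearMap.sub_apply, h4]
      ring
    rw [← hCy, ← hy'] at h3
    have h5 : Q (C *ᵥ y) (C *ᵥ y) = _ := h1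
    have h6 := norm_sq_le_dotProduct_self y
    have h7 : ‖u‖ ^ 2 ≤ m * ‖y‖ ^ 2 := by
      calc ‖u‖ ^ 2 ≤ (‖R‖ * ‖y‖) ^ 2 := by
            gcongr
            conv_lhs => rw [hRy]
            exact Matrix.linfty_opNorm_mulVec _ _
        _ ≤ m * ‖y‖ ^ 2 := by rw [mul_pow, hm]; gcongr; simp
    have h8 : 1 / (4 * m) * ‖u‖ ^ 2 ≤ 1 / 4 * ‖y‖ ^ 2 := by
      rw [show 1 / (4 * m) * ‖u‖ ^ 2 = 1 / 4 * (‖u‖ ^ 2 / m) by field_simp]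
      gcongr
      rwa [div_le_iff₀ hm0, mul_comm]
    have h9 : Q y y = powerSumForm C N y y := rfl
    linarith
  refine ⟨((4 * m) • Q).toContinuousBilinearMap, fun u v => ?_, ⟨4 * m, by positivity, fun u => ?_⟩,
    fun u => ?_⟩
  · simp only [LinearMap.toContinuousBilinearMap_apply, LinearMap.smul_apply]
    rw [show Q u v = Q v u from powerSumForm_comm _ _ _ _]
  · simp only [LinearMap.toContinuousBilinearMap_apply, LinearMap.smul_apply, smul_eq_mul]
    have := hQpos u
    gcongr
  · simp only [LinearMap.toContinuousBilinearMap_apply, LinearMap.smul_apply, smul_eq_mul]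
    have h1 := mul_le_mul_of_nonneg_left (hdec u) (show 0 ≤ 4 * m by positivity)
    have h2 : 4 * m * (-(1 / (4 * m)) * ‖u‖ ^ 2) = -‖u‖ ^ 2 := by field_simp
    linarith

end Hurwitz

/-- A gain: a continuous nonnegative function that is nondecreasing on `[0,∞)`. -/
def IsGain (h : ℝ → ℝ) : Prop :=
  Continuous h ∧ MonotoneOn h (Set.Ici 0) ∧ ∀ r, 0 ≤ h r

namespace IsGain

theorem const {c : ℝ} (hc : 0 ≤ c) : IsGain fun _ => c :=
  ⟨continuous_const, fun _ _ _ _ _ => le_rfl, fun _ => hc⟩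

theorem abs : IsGain fun r => |r| :=
  ⟨continuous_abs, fun x hx y hy hxy => by
    simpa only [abs_of_nonneg (Set.mem_Ici.1 hx), abs_of_nonneg (Set.mem_Ici.1 hy)], abs_nonneg⟩

theorem sqrt : IsGain Real.sqrt :=
  ⟨Real.continuous_sqrt, fun _ _ _ _ h => Real.sqrt_le_sqrt h, Real.sqrt_nonneg⟩

theorem add {f g : ℝ → ℝ} (hf : IsGain f) (hg : IsGain g) : IsGain fun r => f r + g r :=
  ⟨hf.1.add hg.1, fun _ hx _ hy h => add_le_add (hf.2.1 hx hy h) (hg.2.1 hx hy h),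
    fun r => add_nonneg (hf.2.2 r) (hg.2.2 r)⟩

theorem mul {f g : ℝ → ℝ} (hf : IsGain f) (hg : IsGain g) : IsGain fun r => f r * g r :=
  ⟨hf.1.mul hg.1, fun x hx _ hy h =>
    mul_le_mul (hf.2.1 hx hy h) (hg.2.1 hx hy h) (hg.2.2 x) (hf.2.2 _),
    fun r => mul_nonneg (hf.2.2 r) (hg.2.2 r)⟩

theorem sq {f : ℝ → ℝ} (hf : IsGain f) : IsGain fun r => f r ^ 2 := by
  simpa only [pow_two] using hf.mul hf

theorem const_mul {f : ℝ → ℝ} (hf : IsGain f) {c : ℝ} (hc : 0 ≤ c) : IsGain fun r => c * f r :=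
  (const hc).mul hf

theorem comp {f g : ℝ → ℝ} (hf : IsGain f) (hg : IsGain g) : IsGain fun r => f (g r) :=
  ⟨hf.1.comp hg.1, fun x hx y hy h => hf.2.1 (hg.2.2 x) (hg.2.2 y) (hg.2.1 hx hy h),
    fun _ => hf.2.2 _⟩

theorem max_mul_sq_le {h : ℝ → ℝ} (hh : IsGain h) (a b : ℝ) :
    h (max a b) * max a b ^ 2 ≤ h a * a ^ 2 + h b * b ^ 2 := by
  have h1 := mul_nonneg (hh.2.2 a) (sq_nonneg a)
  have h2 := mul_nonneg (hh.2.2 b) (sq_nonneg b)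
  rcases max_choice a b with h | h <;> rw [h] <;> linarith

theorem norm_prod_le {E F : Type*} [NormedAddCommGroup E] [NormedAddCommGroup F] {h : ℝ → ℝ}
    (hh : IsGain h) (x : E) (y : F) :
    h ‖(x, y)‖ * ‖(x, y)‖ ^ 2 ≤ h ‖x‖ * ‖x‖ ^ 2 + h ‖y‖ * ‖y‖ ^ 2 :=
  hh.max_mul_sq_le _ _

end IsGain

/-- A function bounded on balls is dominated by a gain of the norm. -/
theorem exists_isGain_of_bounded_on_balls (s : Set (ℝ × ℝ))
    (hs : ∀ R : ℝ, ∃ m, ∀ x ∈ s, x.1 ≤ R → x.2 ≤ m) :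
    ∃ h, IsGain h ∧ ∀ x ∈ s, x.2 ≤ h x.1 := by
  choose m hm using fun n : ℕ => hs n
  let H : ℝ → ℝ := fun r => ∑ i ∈ Finset.range (⌈r⌉₊ + 1), |m i|
  have hmono : Monotone H := fun r t hrt =>
    Finset.sum_le_sum_of_subset_of_nonneg
      (Finset.range_mono (Nat.succ_le_succ (Nat.ceil_mono hrt))) fun _ _ _ => abs_nonneg _
  have hpos : ∀ r, 0 ≤ H r := fun r => Finset.sum_nonneg fun _ _ => abs_nonneg _
  have hHi : ∀ a b, IntervalIntegrable H MeasureTheory.volume a b := fun a b =>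
    hmono.intervalIntegrable
  have hcont : Continuous fun r => ∫ t in (0 : ℝ)..r, H t :=
    intervalIntegral.continuous_primitive hHi 0
  have hsub : ∀ r, (∫ t in r..(r + 1), H t) = ∫ u in (0 : ℝ)..1, H (u + r) := fun r => by
    rw [intervalIntegral.integral_comp_add_right, zero_add, add_comm]
  have hHi' : ∀ r, IntervalIntegrable (fun u => H (u + r)) MeasureTheory.volume 0 1 := fun r =>
    Monotone.intervalIntegrable fun a b hab => hmono (by gcongr)
  have hle : ∀ r, H r ≤ ∫ t in r..(r + 1), H t := fun r => by
    rw [hsub]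
    have := intervalIntegral.integral_mono_on (μ := MeasureTheory.volume) zero_le_one
      (intervalIntegrable_const (c := H r)) (hHi' r)
      fun u hu => hmono (show r ≤ u + r by linarith [hu.1])
    simpa using this
  refine ⟨fun r => ∫ t in r..(r + 1), H t, ⟨?_, ?_, fun r => (hpos r).trans (hle r)⟩, ?_⟩
  · have : (fun r => ∫ t in r..(r + 1), H t)
        = fun r => (∫ t in (0 : ℝ)..(r + 1), H t) - ∫ t in (0 : ℝ)..r, H t := by
      funext r
      rw [intervalIntegral.integral_interval_sub_left (hHi _ _) (hHi _ _)]
    rw [this]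
    exact (hcont.comp (continuous_id.add continuous_const)).sub hcont
  · intro r _ t _ hrt
    simp only [hsub]
    exact intervalIntegral.integral_mono_on zero_le_one (hHi' r) (hHi' t)
      fun u _ => hmono (by gcongr)
  · intro x hx
    refine le_trans ?_ (hle x.1)
    refine (hm ⌈x.1⌉₊ x hx (Nat.le_ceil _)).trans ((le_abs_self _).trans ?_)
    exact Finset.single_le_sum (f := fun i => |m i|) (fun _ _ => abs_nonneg _)
      (Finset.self_mem_range_succ _)

/-- A `C¹` function vanishing at the origin uniformly in a compact parameter set is bounded by a
gain times the norm. -/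
theorem exists_isGain_norm_le {E P G : Type*} [NormedAddCommGroup E] [NormedSpace ℝ E]
    [FiniteDimensional ℝ E] [NormedAddCommGroup P] [NormedSpace ℝ P]
    [NormedAddCommGroup G] [NormedSpace ℝ G] {F : E × P → G} (hF : ContDiff ℝ 1 F) {K : Set P}
    (hK : IsCompact K) (h0 : ∀ μ ∈ K, F (0, μ) = 0) :
    ∃ L, IsGain L ∧ ∀ z, ∀ μ ∈ K, ‖F (z, μ)‖ ≤ L ‖z‖ * ‖z‖ := by
  obtain ⟨L, hL, hL'⟩ := exists_isGain_of_bounded_on_balls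
    {x : ℝ × ℝ | ∃ z : E, ∃ μ ∈ K, x.1 = ‖z‖ ∧ x.2 * ‖z‖ = ‖F (z, μ)‖ ∧ (‖z‖ = 0 → x.2 = 0)} (by
      intro R
      have hcomp : IsCompact (Metric.closedBall (0 : E) R ×ˢ K) :=
        (isCompact_closedBall 0 R).prod hK
      have hcont : Continuous fun x : E × P => ‖fderiv ℝ F x‖ :=
        (hF.continuous_fderiv one_ne_zero).norm
      obtain ⟨m, hm⟩ := (hcomp.image hcont).bddAbove
      refine ⟨max m 0, ?_⟩
      rintro ⟨a, b⟩ ⟨z, μ, hμ, rfl, hb, hb0⟩ (haR : ‖z‖ ≤ R)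
      simp only at hb hb0 ⊢
      rcases eq_or_ne ‖z‖ 0 with hz | hz
      · rw [hb0 hz]; exact le_max_right _ _
      have hz' : 0 < ‖z‖ := lt_of_le_of_ne (norm_nonneg _) hz.symm
      have hder : ∀ y ∈ Metric.closedBall (0 : E) R ×ˢ ({μ} : Set P),
          DifferentiableAt ℝ F y := fun y _ => hF.differentiable one_ne_zero y
      have hbd : ∀ y ∈ Metric.closedBall (0 : E) R ×ˢ ({μ} : Set P),
          ‖fderiv ℝ F y‖ ≤ m := fun y hy => hm ⟨y, ⟨hy.1, by
            rw [Set.mem_singleton_iff.1 hy.2]; exact hμ⟩, rfl⟩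
      have key := Convex.norm_image_sub_le_of_norm_fderiv_le hder hbd
        ((convex_closedBall 0 R).prod (convex_singleton μ)) (x := (0, μ)) (y := (z, μ))
        (by simpa using (norm_nonneg z).trans haR) (by simpa using haR)
      rw [h0 μ hμ, sub_zero, ← hb, Prod.mk_sub_mk, sub_zero, sub_self, Prod.norm_mk, norm_zero,
        max_eq_left (norm_nonneg _)] at key
      exact le_max_of_le_left (le_of_mul_le_mul_right key hz'))
  refine ⟨L, hL, fun z μ hμ => ?_⟩
  rcases eq_or_ne ‖z‖ 0 with hz | hz
  · rw [norm_eq_zero.1 hz, h0 μ hμ]; simp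
  · have h1 : ‖F (z, μ)‖ / ‖z‖ * ‖z‖ = ‖F (z, μ)‖ := div_mul_cancel₀ _ hz
    have := hL' (‖z‖, ‖F (z, μ)‖ / ‖z‖) ⟨z, μ, hμ, rfl, h1, fun h => absurd h hz⟩
    rw [← h1]
    gcongr

/-- Every continuous real function is dominated by a smooth one. -/
theorem Continuous.exists_contDiff_ge {h : ℝ → ℝ} (hh : Continuous h) :
    ∃ k : ℝ → ℝ, ContDiff ℝ (⊤ : ℕ∞) k ∧ ∀ s, h s ≤ k s := by
  obtain ⟨g, hg⟩ := exists_contMDiffMap_forall_mem_convex_of_local_const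
    (modelWithCornersSelf ℝ ℝ) (n := (⊤ : ℕ∞)) (t := fun s => Set.Ici (h s))
    (fun s => convex_Ici _) fun s => ⟨h s + 1, by
      filter_upwards [hh.continuousAt.eventually (gt_mem_nhds (lt_add_one (h s)))] with y hy
      exact hy.le⟩
  exact ⟨g, g.contMDiff.contDiff, hg⟩

/-- A linear system with Hurwitz matrix and additive disturbance `w` has a Lyapunov function with
arbitrarily prescribed decay gain `h`. -/
theorem IsHurwitz.exists_lyapunov_of_decay {p : ℕ} {M : Matrix (Fin p) (Fin p) ℝ}
    (hM : IsHurwitz M) {h : ℝ → ℝ} (hh : IsGain h) :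
    ∃ V : (Fin p → ℝ) → ℝ, ContDiff ℝ 1 V ∧ (∃ c > 0, ∀ η, c * ‖η‖ ^ 2 ≤ V η) ∧
      (∃ a, IsGain a ∧ ∀ η, V η ≤ a ‖η‖ * ‖η‖ ^ 2) ∧
      ∃ γ, IsGain γ ∧ ∀ η w,
        fderiv ℝ V η (M *ᵥ η + w) ≤ -(h ‖η‖ * ‖η‖ ^ 2) + γ ‖w‖ * ‖w‖ ^ 2 := by
  obtain ⟨B, hB, ⟨c, hc, hBc⟩, hBM⟩ := hM.exists_lyapunov_form
  set C := ‖B‖ + 1 with hC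
  have hC1 : 1 ≤ C := by rw [hC]; linarith [norm_nonneg B]
  have hBC : ∀ u v, B u v ≤ C * ‖u‖ * ‖v‖ := fun u v =>
    (le_abs_self _).trans <| (B.le_opNorm₂ u v).trans (by rw [hC]; gcongr; linarith)
  set g : ℝ → ℝ := fun s => 4 * h (Real.sqrt (c⁻¹ * |s|)) + 1 with hg
  have hgG : IsGain g :=
    ((hh.comp (IsGain.sqrt.comp (IsGain.abs.const_mul (inv_nonneg.2 hc.le)))).const_mul
      (by norm_num)).add (IsGain.const zero_le_one)
  have hg1 : ∀ s, 1 ≤ g s := fun s => by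
    have := hh.2.2 (Real.sqrt (c⁻¹ * |s|)); simp only [hg]; linarith
  have hgi : ∀ a b, IntervalIntegrable g MeasureTheory.volume a b := fun a b =>
    hgG.1.intervalIntegrable a b
  let G : ℝ → ℝ := fun s => ∫ t in (0 : ℝ)..s, g t
  have hGd : ∀ s, HasDerivAt G (g s) s := fun s =>
    intervalIntegral.integral_hasDerivAt_right (hgi _ _)
      hgG.1.stronglyMeasurable.stronglyMeasurableAtFilter hgG.1.continuousAt
  have hGC : ContDiff ℝ 1 G := by
    rw [contDiff_one_iff_deriv]
    refine ⟨fun s => (hGd s).differentiableAt, ?_⟩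
    rw [show deriv G = g from funext fun s => (hGd s).deriv]
    exact hgG.1
  have hGl : ∀ s, 0 ≤ s → s ≤ G s := fun s hs => by
    have := intervalIntegral.integral_mono_on (μ := MeasureTheory.volume) hs
      (intervalIntegrable_const (c := (1 : ℝ))) (hgi 0 s) fun u _ => hg1 u
    simpa using this
  have hGu : ∀ s, 0 ≤ s → G s ≤ s * g s := fun s hs => by
    have := intervalIntegral.integral_mono_on (μ := MeasureTheory.volume) hs (hgi 0 s)
      (intervalIntegrable_const (c := g s))
      fun u hu => hgG.2.1 (Set.mem_Ici.2 hu.1) (Set.mem_Ici.2 hs) hu.2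
    simpa using this
  have hq0 : ∀ η, 0 ≤ B η η := fun η => le_trans (by positivity) (hBc η)
  have hqC : ∀ η, B η η ≤ C * ‖η‖ ^ 2 := fun η => (hBC η η).trans_eq (by ring)
  have hqd : ∀ η, HasFDerivAt (fun η => B η η) ((2 : ℝ) • B η) η := fun η => by
    refine (B.hasFDerivAt_of_bilinear (hasFDerivAt_id η) (hasFDerivAt_id η)).congr_fderiv
      (ContinuousLinearMap.ext fun v => ?_)
    simp [two_mul, hB v η]
  have hVd : ∀ η, HasFDerivAt (fun η => G (B η η)) (g (B η η) • (2 : ℝ) • B η) η := fun η =>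
    (hGd _).comp_hasFDerivAt η (hqd η)
  set κ := 8 * C ^ 3 with hκ
  have hκ0 : 0 ≤ κ := by positivity
  refine ⟨fun η => G (B η η), hGC.comp (B.contDiff.clm_apply contDiff_id), ⟨c, hc, fun η => ?_⟩,
    ⟨fun r => C * g (C * |r| ^ 2), (hgG.comp (IsGain.abs.sq.const_mul (by positivity))).const_mul
      (by positivity), fun η => ?_⟩,
    fun r => κ * g (κ * |r| ^ 2), (hgG.comp (IsGain.abs.sq.const_mul hκ0)).const_mul hκ0,
    fun η w => ?_⟩
  · exact (hBc η).trans (hGl _ (hq0 η))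
  · simp only [abs_norm]
    calc G (B η η) ≤ B η η * g (B η η) := hGu _ (hq0 η)
      _ ≤ (C * ‖η‖ ^ 2) * g (C * ‖η‖ ^ 2) :=
        mul_le_mul (hqC η) (hgG.2.1 (hq0 η) ((hq0 η).trans (hqC η)) (hqC η)) (hgG.2.2 _)
          ((hq0 η).trans (hqC η))
      _ = _ := by ring
  · rw [(hVd η).fderiv]
    simp only [abs_norm, _root_.smul_apply, map_add, smul_eq_mul]
    have h1 := hBM η
    have h2 := hBC η w
    have h3 : 2 * (B η (M *ᵥ η) + B η w) ≤ -(1 / 2) * ‖η‖ ^ 2 + 2 * C ^ 2 * ‖w‖ ^ 2 := by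
      nlinarith [sq_nonneg (‖η‖ - 2 * C * ‖w‖)]
    have hgp := hgG.2.2 (B η η)
    have h4 : g (B η η) * (2 * (B η (M *ᵥ η) + B η w))
        ≤ -(1 / 4) * g (B η η) * ‖η‖ ^ 2 + κ * g (κ * ‖w‖ ^ 2) * ‖w‖ ^ 2 := by
      refine (mul_le_mul_of_nonneg_left h3 hgp).trans ?_
      rcases le_total (8 * C ^ 2 * ‖w‖ ^ 2) (‖η‖ ^ 2) with hcase | hcase
      · have h5 : 0 ≤ κ * g (κ * ‖w‖ ^ 2) * ‖w‖ ^ 2 :=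
          mul_nonneg (mul_nonneg hκ0 (hgG.2.2 _)) (sq_nonneg _)
        nlinarith
      · have h6 : B η η ≤ κ * ‖w‖ ^ 2 := by
          calc B η η ≤ C * ‖η‖ ^ 2 := hqC η
            _ ≤ C * (8 * C ^ 2 * ‖w‖ ^ 2) := by gcongr
            _ = κ * ‖w‖ ^ 2 := by rw [hκ]; ring
        have h7 : g (B η η) ≤ g (κ * ‖w‖ ^ 2) := hgG.2.1 (hq0 η) ((hq0 η).trans h6) h6
        have h8 : 2 * C ^ 2 ≤ κ := by rw [hκ]; nlinarith [sq_nonneg C]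
        have h9 : g (B η η) * (2 * C ^ 2 * ‖w‖ ^ 2) ≤ κ * g (κ * ‖w‖ ^ 2) * ‖w‖ ^ 2 := by
          calc g (B η η) * (2 * C ^ 2 * ‖w‖ ^ 2) ≤ g (κ * ‖w‖ ^ 2) * (κ * ‖w‖ ^ 2) := by
                gcongr
                exact hgG.2.2 _
            _ = _ := by ring
        have h10 := mul_nonneg hgp (sq_nonneg ‖η‖)
        nlinarith
    have h11 : 4 * h ‖η‖ ≤ g (B η η) := by
      have h12 : ‖η‖ ≤ Real.sqrt (c⁻¹ * |B η η|) := by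
        apply Real.le_sqrt_of_sq_le
        rw [abs_of_nonneg (hq0 η), inv_mul_eq_div, le_div_iff₀ hc, mul_comm]
        exact hBc η
      have h13 := hh.2.1 (norm_nonneg η) (Real.sqrt_nonneg _) h12
      simp only [hg]
      linarith
    have h14 := mul_le_mul_of_nonneg_right h11 (sq_nonneg ‖η‖)
    linarith

/-- A bounded time-dependent vector field that is uniformly Lipschitz in the state and continuous
in time has a global integral curve through every point. -/
theorem exists_global_solution_of_lipschitz_of_bounded {E : Type*} [NormedAddCommGroup E]
    [NormedSpace ℝ E] [CompleteSpace E] {v : ℝ → E → E} {L B : NNReal}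
    (hL : ∀ t, LipschitzWith L (v t)) (hc : ∀ x, Continuous fun t => v t x)
    (hB : ∀ t x, ‖v t x‖ ≤ B) (x₀ : E) :
    ∃ u : ℝ → E, u 0 = x₀ ∧ ∀ t, HasDerivAt u (v t (u t)) t := by
  have hloc : ∀ n : ℕ, ∃ u : ℝ → E, u 0 = x₀ ∧
      ∀ t ∈ Set.Ioo (-(n + 1 : ℝ)) (n + 1), HasDerivAt u (v t (u t)) t := fun n => by
    have hn : (0 : ℝ) ∈ Set.Icc (-(n + 1 : ℝ)) (n + 1) :=
      ⟨by linarith [n.cast_nonneg (α := ℝ)], by positivity⟩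
    have hpl : IsPicardLindelof v (tmin := -(n + 1 : ℝ)) (tmax := n + 1) ⟨0, hn⟩ x₀
        (B * (n + 1)) 0 B L :=
      { lipschitzOnWith := fun t _ => (hL t).lipschitzOnWith
        continuousOn := fun x _ => (hc x).continuousOn
        norm_le := fun t _ x _ => hB t x
        mul_max_le := by simp }
    obtain ⟨u, hu0, hu⟩ := hpl.exists_eq_forall_mem_Icc_hasDerivWithinAt₀
    exact ⟨u, hu0, fun t ht => (hu t (Set.Ioo_subset_Icc_self ht)).hasDerivAt
      (Icc_mem_nhds ht.1 ht.2)⟩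
  choose u hu0 hu using hloc
  have heq : ∀ m n : ℕ, m ≤ n → Set.EqOn (u m) (u n) (Set.Ioo (-(m + 1 : ℝ)) (m + 1)) :=
    fun m n hmn => by
      have hmn' : (m : ℝ) ≤ n := by exact_mod_cast hmn
      exact ODE_solution_unique_of_mem_Ioo (v := v) (s := fun _ => Set.univ) (K := L) (t₀ := 0)
        (fun t _ => (hL t).lipschitzOnWith)
        ⟨by linarith [m.cast_nonneg (α := ℝ)], by positivity⟩
        (fun t ht => ⟨hu m t ht, trivial⟩)
        (fun t ht => ⟨hu n t ⟨by linarith [ht.1], by linarith [ht.2]⟩, trivial⟩)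
        ((hu0 m).trans (hu0 n).symm)
  have hglue : ∀ n : ℕ, ∀ t ∈ Set.Ioo (-(n + 1 : ℝ)) (n + 1), u ⌈|t|⌉₊ t = u n t := by
    intro n t ht
    have ht' : t ∈ Set.Ioo (-((⌈|t|⌉₊ : ℝ) + 1)) (⌈|t|⌉₊ + 1) := by
      rw [Set.mem_Ioo, ← abs_lt]
      linarith [Nat.le_ceil |t|]
    rcases le_total ⌈|t|⌉₊ n with h | h
    · exact heq _ _ h ht'
    · exact (heq _ _ h ht).symm
  refine ⟨fun t => u ⌈|t|⌉₊ t, by simpa using hu0 _, fun t => ?_⟩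
  have ht' : t ∈ Set.Ioo (-((⌈|t|⌉₊ : ℝ) + 1)) (⌈|t|⌉₊ + 1) := by
    rw [Set.mem_Ioo, ← abs_lt]
    linarith [Nat.le_ceil |t|]
  refine (hu ⌈|t|⌉₊ t ht').congr_of_eventuallyEq ?_
  filter_upwards [isOpen_Ioo.mem_nhds ht'] with s hs
  exact hglue _ s hs

theorem IsClassKInfty.exists_le_of_le {α : ℝ → ℝ} (hα : IsClassKInfty α) (m : ℝ) :
    ∃ c, ∀ r, α r ≤ m → r ≤ c := by
  obtain ⟨c, hc⟩ := (hα.2.2.2.2.eventually (Filter.eventually_gt_atTop m)).exists_forall_of_atTop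
  refine ⟨c, fun r hr => ?_⟩
  by_contra h
  exact absurd (hc r (le_of_not_ge h)) (not_lt.2 hr)

/-- A differentiable function whose derivative along a curve is at most `-c` satisfies
`V (u t) + c * t` nonincreasing. -/
theorem antitoneOn_add_mul_of_fderiv_le {E : Type*} [NormedAddCommGroup E] [NormedSpace ℝ E]
    {V : E → ℝ} (hV : Differentiable ℝ V) {u u' : ℝ → E} {c : ℝ}
    (hu : ∀ t ∈ Set.Ici (0 : ℝ), HasDerivAt u (u' t) t)
    (hd : ∀ t ∈ Set.Ici (0 : ℝ), fderiv ℝ V (u t) (u' t) ≤ -c) :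
    AntitoneOn (fun t => V (u t) + c * t) (Set.Ici 0) := by
  have hder : ∀ t ∈ Set.Ici (0 : ℝ),
      HasDerivAt (fun t => V (u t) + c * t) (fderiv ℝ V (u t) (u' t) + c) t := fun t ht => by
    have := ((hV (u t)).hasFDerivAt.comp_hasDerivAt t (hu t ht)).add
      ((hasDerivAt_id t).const_mul c)
    rwa [mul_one] at this
  refine antitoneOn_of_deriv_nonpos (convex_Ici 0)
    (fun t ht => (hder t ht).continuousAt.continuousWithinAt)
    (fun t ht => (hder t (interior_subset ht)).differentiableAt.differentiableWithinAt)
    fun t ht => ?_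
  rw [(hder t (interior_subset ht)).deriv]
  linarith [hd t (interior_subset ht)]

/-- Lyapunov's theorem: a curve along which a strict Lyapunov function decays is bounded and tends
to the origin. -/
theorem bounded_and_tendsto_zero_of_lyapunov {E : Type*} [NormedAddCommGroup E] [NormedSpace ℝ E]
    {V : E → ℝ} (hV : Differentiable ℝ V) {α₀ α₁ : ℝ → ℝ} (h₀ : IsClassKInfty α₀)
    (h₁ : IsClassKInfty α₁) (hVα : ∀ z, α₀ ‖z‖ ≤ V z ∧ V z ≤ α₁ ‖z‖) {u u' : ℝ → E}
    (hu : ∀ t ∈ Set.Ici (0 : ℝ), HasDerivAt u (u' t) t)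
    (hd : ∀ t ∈ Set.Ici (0 : ℝ), fderiv ℝ V (u t) (u' t) ≤ -‖u t‖ ^ 2) :
    (∃ c : ℝ, ∀ t ∈ Set.Ici (0 : ℝ), ‖u t‖ ≤ c) ∧ Filter.Tendsto u Filter.atTop (nhds 0) := by
  have hanti : AntitoneOn (fun t => V (u t)) (Set.Ici 0) := by
    simpa using antitoneOn_add_mul_of_fderiv_le hV (c := 0) hu
      fun t ht => (hd t ht).trans (by simp)
  refine ⟨?_, ?_⟩
  · obtain ⟨c, hc⟩ := h₀.exists_le_of_le (V (u 0))
    exact ⟨c, fun t ht => hc _ ((hVα _).1.trans (hanti Set.self_mem_Ici ht ht))⟩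
  · rw [tendsto_zero_iff_norm_tendsto_zero]
    refine tendsto_order.2 ⟨fun a ha => Filter.Eventually.of_forall fun t =>
      ha.trans_le (norm_nonneg _), fun ε hε => ?_⟩
    have hε' : 0 < α₀ ε := by
      have := h₀.2.1 Set.self_mem_Ici hε.le hε
      rwa [h₀.2.2.1] at this
    have hev : ∀ᶠ r in nhdsWithin 0 (Set.Ici 0), α₁ r < α₀ ε := by
      have := h₁.1 0 Set.self_mem_Ici
      rw [ContinuousWithinAt, h₁.2.2.1] at this
      exact this.eventually (gt_mem_nhds hε')
    rw [eventually_nhdsWithin_iff, Metric.eventually_nhds_iff] at hev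
    obtain ⟨δ, hδ, hδ'⟩ := hev
    have hT : ∃ T ∈ Set.Ici (0 : ℝ), ‖u T‖ < δ := by
      by_contra! hcon
      have hmono := antitoneOn_add_mul_of_fderiv_le hV (c := δ ^ 2) hu fun t ht =>
        (hd t ht).trans (neg_le_neg (pow_le_pow_left₀ hδ.le (hcon t ht) 2))
      set T := (V (u 0) + 1) / δ ^ 2 with hTdef
      have hV0 : ∀ z, 0 ≤ V z := fun z => (h₀.2.2.2.1 _ (norm_nonneg z)).trans (hVα z).1
      have hT0 : 0 ≤ T := div_nonneg (by linarith [hV0 (u 0)]) (by positivity)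
      have h2 := hmono Set.self_mem_Ici (Set.mem_Ici.2 hT0) hT0
      have h3 : δ ^ 2 * T = V (u 0) + 1 := mul_div_cancel₀ _ (by positivity)
      simp only [mul_zero, add_zero, h3] at h2
      linarith [hV0 (u T)]
    obtain ⟨T, hT0, hT⟩ := hT
    filter_upwards [Filter.eventually_ge_atTop T] with t ht
    have ht0 : t ∈ Set.Ici (0 : ℝ) := le_trans hT0 ht
    have h1 : α₀ ‖u t‖ < α₀ ε := calc
      α₀ ‖u t‖ ≤ V (u t) := (hVα _).1
      _ ≤ V (u T) := hanti hT0 ht0 ht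
      _ ≤ α₁ ‖u T‖ := (hVα _).2
      _ < α₀ ε := hδ' (by simpa using hT) (norm_nonneg _)
    exact (h₀.2.1.lt_iff_lt (norm_nonneg _) hε.le).1 h1

/-- The product of a bump function with a `C¹` map is Lipschitz and bounded. -/
theorem ContDiffBump.lipschitzWith_smul_and_bounded {E F : Type*} [NormedAddCommGroup E]
    [NormedSpace ℝ E] [FiniteDimensional ℝ E] [NormedAddCommGroup F] [NormedSpace ℝ F] {x : E}
    (χ : ContDiffBump x) {X : E → F} (hX : ContDiff ℝ 1 X) :
    (∃ L, LipschitzWith L fun y => χ y • X y) ∧ ∃ B, ∀ y, ‖χ y • X y‖ ≤ B := by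
  have hsm : ContDiff ℝ 1 fun y => χ y • X y := χ.contDiff.smul hX
  have hsupp : HasCompactSupport fun y => χ y • X y := χ.hasCompactSupport.smul_right
  exact ⟨ContDiff.lipschitzWith_of_hasCompactSupport hsupp hsm one_ne_zero,
    hsupp.exists_bound_of_continuous hsm.continuous⟩

/-- A parameter-affine vector field with a proper nonincreasing Lyapunov function is forward
complete. -/
theorem exists_forward_solution_of_lyapunov {E P : Type*} [NormedAddCommGroup E]
    [NormedSpace ℝ E] [FiniteDimensional ℝ E] [NormedAddCommGroup P] [NormedSpace ℝ P]
    [FiniteDimensional ℝ P] {A D : E × P → E} (hA : ContDiff ℝ 1 A) (hD : ContDiff ℝ 1 D)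
    {b : P → ℝ} (hb : Continuous b) {K : Set P} (hK : IsCompact K) {V : E → ℝ}
    (hV : Differentiable ℝ V) (hVc : ∀ m, ∃ c, ∀ z, V z ≤ m → ‖z‖ ≤ c)
    (hd : ∀ z, ∀ μ ∈ K, fderiv ℝ V z (A (z, μ) + b μ • D (z, μ)) ≤ 0)
    {μ : ℝ → P} (hμ : Continuous μ) (hμK : ∀ t, μ t ∈ K) (z₀ : E) :
    ∃ u : ℝ → E, u 0 = z₀ ∧
      ∀ t ∈ Set.Ici (0 : ℝ), HasDerivAt u (A (u t, μ t) + b (μ t) • D (u t, μ t)) t := by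
  obtain ⟨c, hc⟩ := hVc (V z₀)
  obtain ⟨k, hk⟩ := hK.isBounded.exists_norm_le
  obtain ⟨β, hβ⟩ := (hK.image hb.norm).bddAbove
  have hβ' : ∀ ν ∈ K, ‖b ν‖ ≤ |β| := fun ν hν => (hβ ⟨ν, hν, rfl⟩).trans (le_abs_self β)
  set R := max 1 (max c k) with hR
  have hR0 : 0 < R := lt_of_lt_of_le one_pos (le_max_left _ _)
  let χ : ContDiffBump (0 : E × P) := ⟨R, R + 1, hR0, lt_add_one R⟩
  obtain ⟨⟨L₁, hL₁⟩, B₁, hB₁⟩ := χ.lipschitzWith_smul_and_bounded hA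
  obtain ⟨⟨L₂, hL₂⟩, B₂, hB₂⟩ := χ.lipschitzWith_smul_and_bounded hD
  let v : ℝ → E → E := fun t z =>
    χ (z, μ t) • A (z, μ t) + b (μ t) • (χ (z, μ t) • D (z, μ t))
  have hvL : ∀ t, LipschitzWith (L₁ + ‖β‖₊ * L₂) (v t) := fun t => by
    refine LipschitzWith.of_dist_le_mul fun x y => ?_
    have h1 := hL₁.dist_le_mul (x, μ t) (y, μ t)
    have h2 := hL₂.dist_le_mul (x, μ t) (y, μ t)
    have hxy : dist (x, μ t) (y, μ t) = dist x y := by simp [Prod.dist_eq]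
    rw [hxy] at h1 h2
    calc dist (v t x) (v t y) ≤ _ := dist_add_add_le _ _ _ _
      _ ≤ L₁ * dist x y + |β| * (L₂ * dist x y) := by
        rw [dist_smul₀]
        exact add_le_add h1 (mul_le_mul (hβ' _ (hμK t)) h2 dist_nonneg (abs_nonneg _))
      _ = _ := by
        push_cast
        rw [Real.norm_eq_abs]
        ring
  have hvc : ∀ z, Continuous fun t => v t z := fun z => by
    have hpair : Continuous fun t => (z, μ t) := continuous_const.prodMk hμ
    have hχ : Continuous fun t => χ (z, μ t) := χ.continuous.comp hpair
    exact (hχ.smul (hA.continuous.comp hpair)).add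
      ((hb.comp hμ).smul (hχ.smul (hD.continuous.comp hpair)))
  have hvB : ∀ t z, ‖v t z‖ ≤ (‖B₁‖₊ + ‖β‖₊ * ‖B₂‖₊ : NNReal) := fun t z => by
    refine (norm_add_le _ _).trans ?_
    rw [norm_smul (b (μ t))]
    push_cast
    refine add_le_add ((hB₁ _).trans (le_abs_self _))
      (mul_le_mul (hβ' _ (hμK t)) ((hB₂ _).trans (le_abs_self _)) (norm_nonneg _) (abs_nonneg _))
  obtain ⟨u, hu0, hu⟩ := exists_global_solution_of_lipschitz_of_bounded hvL hvc hvB z₀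
  have hv_eq : ∀ t z, v t z = χ (z, μ t) • (A (z, μ t) + b (μ t) • D (z, μ t)) := fun t z => by
    simp only [v, smul_add]
    rw [smul_comm]
  have hanti : AntitoneOn (fun t => V (u t)) (Set.Ici 0) := by
    simpa using antitoneOn_add_mul_of_fderiv_le hV (c := 0) (fun t _ => hu t) fun t _ => by
      rw [hv_eq, map_smul, smul_eq_mul, neg_zero]
      exact mul_nonpos_of_nonneg_of_nonpos χ.nonneg (hd _ _ (hμK t))
  refine ⟨u, hu0, fun t ht => ?_⟩
  have hnorm : ‖u t‖ ≤ c := hc _ (by simpa [hu0] using hanti Set.self_mem_Ici ht ht)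
  have hone : χ (u t, μ t) = 1 := by
    refine χ.one_of_mem_closedBall ?_
    rw [mem_closedBall_zero_iff, Prod.norm_def]
    exact max_le (hnorm.trans ((le_max_left _ _).trans (le_max_right _ _)))
      ((hk _ (hμK t)).trans ((le_max_right _ _).trans (le_max_right _ _)))
  have := hu t
  rwa [hv_eq, hone, one_smul] at this

theorem IsGain.isClassKInfty_add_mul_sq {a : ℝ → ℝ} (ha : IsGain a) {c : ℝ} (hc : 0 < c) :
    IsClassKInfty fun r => (a r + c) * r ^ 2 := by
  refine ⟨((ha.1.add continuous_const).mul (continuous_pow 2)).continuousOn, ?_, by simp, ?_, ?_⟩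
  · intro r hr s hs hrs
    have h1 : a r ≤ a s := ha.2.1 hr hs hrs.le
    have h2 : r ^ 2 < s ^ 2 := pow_lt_pow_left₀ hrs hr two_ne_zero
    exact mul_lt_mul' (by linarith) h2 (sq_nonneg r) (by linarith [ha.2.2 s])
  · intro r hr
    have := ha.2.2 r
    positivity
  · refine tendsto_atTop_mono' _ ?_
      ((tendsto_pow_atTop (α := ℝ) two_ne_zero).const_mul_atTop hc)
    filter_upwards [eventually_ge_atTop 0] with r hr
    exact mul_le_mul_of_nonneg_right (by linarith [ha.2.2 r]) (sq_nonneg r)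

theorem sq_norm_prod_le_add {E F : Type*} [NormedAddCommGroup E] [NormedAddCommGroup F]
    (x : E) (y : F) : ‖(x, y)‖ ^ 2 ≤ ‖x‖ ^ 2 + ‖y‖ ^ 2 := by
  simpa using (IsGain.const (c := 1) zero_le_one).norm_prod_le x y

theorem hasDerivAt_prod_components {E F : Type*} [NormedAddCommGroup E] [NormedSpace ℝ E]
    [NormedAddCommGroup F] [NormedSpace ℝ F] {u : ℝ → E × F} {u' : E × F} {t : ℝ}
    (h : HasDerivAt u u' t) :
    HasDerivAt (fun s => (u s).1) u'.1 t ∧ HasDerivAt (fun s => (u s).2) u'.2 t :=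
  ⟨(hasFDerivAt_fst (𝕜 := ℝ) (p := u t)).comp_hasDerivAt t h,
    (hasFDerivAt_snd (𝕜 := ℝ) (p := u t)).comp_hasDerivAt t h⟩

/-- The composite function `V₁(η₁) + x² / 2 + V₂(η₂) + ζ² / 2`. -/
noncomputable def cascadeLyapunov {E₁ E₂ : Type*} (V₁ : E₁ → ℝ) (V₂ : E₂ → ℝ)
    (z : E₁ × ℝ × E₂ × ℝ) : ℝ :=
  V₁ z.1 + z.2.1 ^ 2 / 2 + (V₂ z.2.2.1 + z.2.2.2 ^ 2 / 2)

theorem contDiff_cascadeLyapunov {E₁ E₂ : Type*} [NormedAddCommGroup E₁] [NormedSpace ℝ E₁]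
    [NormedAddCommGroup E₂] [NormedSpace ℝ E₂] {V₁ : E₁ → ℝ} {V₂ : E₂ → ℝ}
    (h₁ : ContDiff ℝ 1 V₁) (h₂ : ContDiff ℝ 1 V₂) : ContDiff ℝ 1 (cascadeLyapunov V₁ V₂) := by
  unfold cascadeLyapunov
  fun_prop

theorem fderiv_cascadeLyapunov {E₁ E₂ : Type*} [NormedAddCommGroup E₁] [NormedSpace ℝ E₁]
    [NormedAddCommGroup E₂] [NormedSpace ℝ E₂] {V₁ : E₁ → ℝ} {V₂ : E₂ → ℝ}
    (h₁ : Differentiable ℝ V₁) (h₂ : Differentiable ℝ V₂) (η₁ v₁ : E₁)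
    (x v : ℝ) (η₂ v₂ : E₂) (ζ w : ℝ) :
    fderiv ℝ (cascadeLyapunov V₁ V₂) (η₁, x, η₂, ζ) (v₁, v, v₂, w) =
      fderiv ℝ V₁ η₁ v₁ + x * v + (fderiv ℝ V₂ η₂ v₂ + ζ * w) := by
  have hsq (y u : ℝ) : HasDerivAt (fun t : ℝ => (y + t * u) ^ 2 / 2) (y * u) 0 := by
    have hl : HasDerivAt (fun t : ℝ => y + t * u) u 0 := by
      simpa using ((hasDerivAt_id (0 : ℝ)).mul_const u).const_add y
    refine ((hl.fun_pow 2).div_const 2).congr_deriv ?_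
    norm_num
    ring
  have hVd : Differentiable ℝ (cascadeLyapunov V₁ V₂) := by
    unfold cascadeLyapunov
    fun_prop
  have hd₁ : HasDerivAt (fun t : ℝ => V₁ (η₁ + t • v₁)) (fderiv ℝ V₁ η₁ v₁) 0 :=
    (h₁ η₁).hasFDerivAt.hasLineDerivAt v₁
  have hd₂ : HasDerivAt (fun t : ℝ => V₂ (η₂ + t • v₂)) (fderiv ℝ V₂ η₂ v₂) 0 :=
    (h₂ η₂).hasFDerivAt.hasLineDerivAt v₂
  have hd : HasDerivAt
      (fun t : ℝ => cascadeLyapunov V₁ V₂ ((η₁, x, η₂, ζ) + t • (v₁, v, v₂, w)))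
      (fderiv ℝ (cascadeLyapunov V₁ V₂) (η₁, x, η₂, ζ) (v₁, v, v₂, w)) 0 :=
    (hVd (η₁, x, η₂, ζ)).hasFDerivAt.hasLineDerivAt (v₁, v, v₂, w)
  exact hd.unique ((hd₁.add (hsq x v)).add (hd₂.add (hsq ζ w)))

theorem exists_isClassKInfty_bounds_cascadeLyapunov {E₁ E₂ : Type*}
    [NormedAddCommGroup E₁] [NormedAddCommGroup E₂] {V₁ : E₁ → ℝ} {V₂ : E₂ → ℝ}
    (h₁ : ∃ c > 0, ∀ η, c * ‖η‖ ^ 2 ≤ V₁ η) (h₂ : ∃ c > 0, ∀ η, c * ‖η‖ ^ 2 ≤ V₂ η)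
    (h₁' : ∃ a, IsGain a ∧ ∀ η, V₁ η ≤ a ‖η‖ * ‖η‖ ^ 2)
    (h₂' : ∃ a, IsGain a ∧ ∀ η, V₂ η ≤ a ‖η‖ * ‖η‖ ^ 2) :
    ∃ α₀ α₁ : ℝ → ℝ, IsClassKInfty α₀ ∧ IsClassKInfty α₁ ∧
      ∀ z, α₀ ‖z‖ ≤ cascadeLyapunov V₁ V₂ z ∧ cascadeLyapunov V₁ V₂ z ≤ α₁ ‖z‖ := by
  obtain ⟨c₁, hc₁, hV₁⟩ := h₁
  obtain ⟨c₂, hc₂, hV₂⟩ := h₂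
  obtain ⟨a₁, ha₁, hVa₁⟩ := h₁'
  obtain ⟨a₂, ha₂, hVa₂⟩ := h₂'
  have hc : 0 < min (min c₁ c₂) (1 / 2) := lt_min (lt_min hc₁ hc₂) one_half_pos
  refine ⟨_, _, (IsGain.const le_rfl).isClassKInfty_add_mul_sq hc,
    (ha₁.add ha₂).isClassKInfty_add_mul_sq one_pos, fun ⟨η₁, x, η₂, ζ⟩ => ⟨?_, ?_⟩⟩
  · have e₁ := sq_norm_prod_le_add η₁ (x, η₂, ζ)
    have e₂ := sq_norm_prod_le_add x (η₂, ζ)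
    have e₃ := sq_norm_prod_le_add η₂ ζ
    rw [Real.norm_eq_abs, sq_abs] at e₂ e₃
    set c := min (min c₁ c₂) (1 / 2)
    have k₁ : c ≤ c₁ := (min_le_left _ _).trans (min_le_left _ _)
    have k₂ : c ≤ c₂ := (min_le_left _ _).trans (min_le_right _ _)
    have k₃ : c ≤ 1 / 2 := min_le_right _ _
    have hsum := mul_le_mul_of_nonneg_left (e₁.trans (add_le_add_right
      (e₂.trans (add_le_add_right e₃ _)) _)) hc.le
    simp only [cascadeLyapunov]
    linarith [hV₁ η₁, hV₂ η₂, mul_le_mul_of_nonneg_right k₁ (sq_nonneg ‖η₁‖),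
      mul_le_mul_of_nonneg_right k₂ (sq_nonneg ‖η₂‖),
      mul_le_mul_of_nonneg_right k₃ (sq_nonneg x), mul_le_mul_of_nonneg_right k₃ (sq_nonneg ζ)]
  · set z := (η₁, x, η₂, ζ) with hz
    have n₁ : ‖η₁‖ ≤ ‖z‖ := norm_fst_le z
    have n₂ : ‖z.2‖ ≤ ‖z‖ := norm_snd_le z
    have n₃ : ‖x‖ ≤ ‖z‖ := (norm_fst_le z.2).trans n₂
    have n₄ : ‖z.2.2‖ ≤ ‖z‖ := (norm_snd_le z.2).trans n₂
    have n₅ : ‖η₂‖ ≤ ‖z‖ := (norm_fst_le z.2.2).trans n₄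
    have n₆ : ‖ζ‖ ≤ ‖z‖ := (norm_snd_le z.2.2).trans n₄
    have hsq {r : ℝ} (hr : ‖r‖ ≤ ‖z‖) : r ^ 2 ≤ ‖z‖ ^ 2 := by
      rw [← sq_abs r]
      exact pow_le_pow_left₀ (abs_nonneg r) hr 2
    have hgain {a : ℝ → ℝ} (ha : IsGain a) {r : ℝ} (hr₀ : 0 ≤ r) (hr : r ≤ ‖z‖) :
        a r * r ^ 2 ≤ a ‖z‖ * ‖z‖ ^ 2 :=
      mul_le_mul (ha.2.1 hr₀ (norm_nonneg z) hr) (pow_le_pow_left₀ hr₀ hr 2) (sq_nonneg r)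
        (ha.2.2 _)
    have : cascadeLyapunov V₁ V₂ z = V₁ η₁ + x ^ 2 / 2 + (V₂ η₂ + ζ ^ 2 / 2) := rfl
    rw [this]
    linarith [(hVa₁ η₁).trans (hgain ha₁ (norm_nonneg _) n₁),
      (hVa₂ η₂).trans (hgain ha₂ (norm_nonneg _) n₅), hsq n₃, hsq n₆]

/-- Lyapunov redesign for a cascade of two Hurwitz-driven subsystems interlaced with two scalar
equations: when all interconnections have linear-growth gains, smooth high-gain scalar feedbacks
render a composite function strictly decreasing. -/
theorem exists_cascade_lyapunov {p₁ p₂ : ℕ} {M₁ : Matrix (Fin p₁) (Fin p₁) ℝ}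
    (hM₁ : IsHurwitz M₁) {M₂ : Matrix (Fin p₂) (Fin p₂) ℝ} (hM₂ : IsHurwitz M₂)
    (N : Fin p₁ → ℝ) {g l L : ℝ → ℝ} (hg : IsGain g) (hl : IsGain l) (hL : IsGain L) :
    ∃ ρ : ℝ → ℝ, ContDiff ℝ (⊤ : ℕ∞) ρ ∧ (∀ s, 0 < ρ s) ∧
    ∃ k : ℝ → ℝ, ContDiff ℝ (⊤ : ℕ∞) k ∧ (∀ s, 1 ≤ k s) ∧
    ∃ V : (Fin p₁ → ℝ) × ℝ × (Fin p₂ → ℝ) × ℝ → ℝ, ContDiff ℝ 1 V ∧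
    ∃ α₀ α₁ : ℝ → ℝ, IsClassKInfty α₀ ∧ IsClassKInfty α₁ ∧
      (∀ z, α₀ ‖z‖ ≤ V z ∧ V z ≤ α₁ ‖z‖) ∧
      ∀ (η₁ : Fin p₁ → ℝ) (x : ℝ) (η₂ : Fin p₂ → ℝ) (ζ s : ℝ) (q : Fin p₂ → ℝ) (φ κ : ℝ),
        ‖s‖ ≤ g ‖(η₁, x)‖ * ‖(η₁, x)‖ → ‖q‖ ≤ l ‖(x, η₁, ζ)‖ * ‖(x, η₁, ζ)‖ →
        ‖φ‖ ≤ L ‖(η₁, x, η₂, ζ)‖ * ‖(η₁, x, η₂, ζ)‖ → 1 ≤ κ →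
        fderiv ℝ V (η₁, x, η₂, ζ)
            (M₁ *ᵥ η₁ + x • N, ζ - ρ x * x + s, M₂ *ᵥ η₂ + q, φ - κ * (k ζ * ζ)) ≤
          -‖η₁‖ ^ 2 - ‖η₂‖ ^ 2 - x ^ 2 - ζ ^ 2 := by
  have hG := hg.sq
  have hΛ := hL.sq
  have hhalf : (0 : ℝ) ≤ 1 / 2 := by norm_num
  obtain ⟨V₂, hV₂, hV₂l, hV₂u, γ₂, hγ₂, hd₂⟩ :=
    hM₂.exists_lyapunov_of_decay ((hΛ.const_mul hhalf).add (IsGain.const zero_le_one))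
  obtain ⟨Ψ, hΨ, hΨq⟩ : ∃ Ψ, IsGain Ψ ∧ ∀ r t, 0 ≤ r → 0 ≤ t → t ≤ l r * r →
      γ₂ t * t ^ 2 ≤ Ψ r * r ^ 2 := by
    refine ⟨fun r => γ₂ (l r * |r|) * l r ^ 2, (hγ₂.comp (hl.mul IsGain.abs)).mul hl.sq,
      fun r t hr ht htr => ?_⟩
    have h0 : 0 ≤ l r * r := ht.trans htr
    calc γ₂ t * t ^ 2 ≤ γ₂ (l r * r) * (l r * r) ^ 2 :=
          mul_le_mul (hγ₂.2.1 ht h0 htr) (pow_le_pow_left₀ ht htr 2) (sq_nonneg t)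
            (hγ₂.2.2 _)
      _ = _ := by
        simp only [abs_of_nonneg hr]
        ring
  obtain ⟨V₁, hV₁, hV₁l, hV₁u, γ₁, hγ₁, hd₁⟩ := hM₁.exists_lyapunov_of_decay
    ((((hG.const_mul hhalf).add hΨ).add (hΛ.const_mul hhalf)).add (IsGain.const zero_le_one))
  have hγ₁c := hγ₁.1
  have hgc := hg.1
  have hΨc := hΨ.1
  have hLc := hL.1
  obtain ⟨ρ, hρ, hρ_le⟩ := Continuous.exists_contDiff_ge (h := fun x =>
    γ₁ (|x| * ‖N‖) * ‖N‖ ^ 2 + 1 / 2 * g |x| ^ 2 + Ψ |x| + 1 / 2 * L |x| ^ 2 + 2) (by fun_prop)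
  obtain ⟨k, hk, hk_le⟩ := Continuous.exists_contDiff_ge (h := fun ζ =>
    Ψ |ζ| + 1 / 2 * L |ζ| ^ 2 + 2) (by fun_prop)
  have hk₁ (s : ℝ) : 1 ≤ k s := by
    have h1 := hΨ.2.2 |s|
    linarith [hk_le s, sq_nonneg (L |s|)]
  obtain ⟨α₀, α₁, hα₀, hα₁, hα⟩ :=
    exists_isClassKInfty_bounds_cascadeLyapunov hV₁l hV₂l hV₁u hV₂u
  refine ⟨ρ, hρ, fun s => ?_, k, hk, hk₁, cascadeLyapunov V₁ V₂,
    contDiff_cascadeLyapunov hV₁ hV₂, α₀, α₁, hα₀, hα₁, hα, ?_⟩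
  · have h1 := hΨ.2.2 |s|
    have h2 : 0 ≤ γ₁ (|s| * ‖N‖) := hγ₁.2.2 _
    have h3 := mul_nonneg h2 (sq_nonneg ‖N‖)
    linarith [hρ_le s, sq_nonneg (L |s|), sq_nonneg (g |s|)]
  intro η₁ x η₂ ζ s q φ κ hs hq hφ hκ
  rw [fderiv_cascadeLyapunov (hV₁.differentiable one_ne_zero) (hV₂.differentiable one_ne_zero)]
  have e₁ := hd₁ η₁ (x • N)
  rw [norm_smul, Real.norm_eq_abs, mul_pow, sq_abs] at e₁
  have e₂ := hd₂ η₂ q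
  have hs' : s ^ 2 ≤ g ‖η₁‖ ^ 2 * ‖η₁‖ ^ 2 + g |x| ^ 2 * x ^ 2 := by
    have h1 := hG.norm_prod_le η₁ x
    have h2 := pow_le_pow_left₀ (norm_nonneg s) hs 2
    simp only [Real.norm_eq_abs, sq_abs, mul_pow] at h1 h2
    exact h2.trans h1
  have hq' : γ₂ ‖q‖ * ‖q‖ ^ 2 ≤ Ψ |x| * x ^ 2 + (Ψ ‖η₁‖ * ‖η₁‖ ^ 2 + Ψ |ζ| * ζ ^ 2) := by
    have h1 := hΨ.norm_prod_le x (η₁, ζ)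
    have h2 := hΨ.norm_prod_le η₁ ζ
    have h3 := hΨq _ _ (norm_nonneg _) (norm_nonneg q) hq
    simp only [Real.norm_eq_abs, sq_abs] at h1 h2
    linarith
  have hφ' : φ ^ 2 ≤ L ‖η₁‖ ^ 2 * ‖η₁‖ ^ 2 + (L |x| ^ 2 * x ^ 2 +
      (L ‖η₂‖ ^ 2 * ‖η₂‖ ^ 2 + L |ζ| ^ 2 * ζ ^ 2)) := by
    have h1 := hΛ.norm_prod_le η₁ (x, η₂, ζ)
    have h2 := hΛ.norm_prod_le x (η₂, ζ)
    have h3 := hΛ.norm_prod_le η₂ ζ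
    have h4 := pow_le_pow_left₀ (norm_nonneg φ) hφ 2
    simp only [Real.norm_eq_abs, sq_abs, mul_pow] at h1 h2 h3 h4
    linarith
  have hρx := mul_le_mul_of_nonneg_right (hρ_le x) (sq_nonneg x)
  have hkζ := mul_le_mul_of_nonneg_right (hk_le ζ) (sq_nonneg ζ)
  have hκζ := mul_le_mul_of_nonneg_right hκ
    (mul_nonneg (zero_le_one.trans (hk₁ ζ)) (sq_nonneg ζ))
  linarith [two_mul_le_add_sq x ζ, two_mul_le_add_sq x s, two_mul_le_add_sq ζ φ]

/-- Lemma 3: the nonadaptive feedback `ū = −k₀ k(ζ)ζ` globally stabilizes the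
augmented error system `η̄₁' = M₁η̄₁ + M₁N₁x̄₁`, `x̄₁' = ζ − ρ(x̄₁)x̄₁ + χ̃₁(η̄₁,x̄₁)`,
`η̄₂' = M₂η̄₂ + p̃(x̄₁,η̄₁,ζ,μ)`, `ζ' = f̃(x̄₁,η̄₁,ζ,μ) + b̄(μ)χ̃₂(x̄₁,η̄₁,η̄₂,ζ,μ) + b̄(μ)ū`,
with a strict Lyapunov function, and every maximal closed-loop solution is global,
bounded, and converges to the origin. -/
theorem nonadaptive_stabilization_of_augmented_system
    {p₁ p₂ d : ℕ} (hp₁ : 1 ≤ p₁) (hp₂ : 1 ≤ p₂) (hd : 1 ≤ d)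
    (M₁ : Matrix (Fin p₁) (Fin p₁) ℝ) (hM₁ : IsHurwitz M₁)
    (M₂ : Matrix (Fin p₂) (Fin p₂) ℝ) (hM₂ : IsHurwitz M₂)
    (N₁ : Fin p₁ → ℝ)
    (K : Set (Fin d → ℝ)) (hK : IsCompact K)
    (χ₁' : (Fin p₁ → ℝ) × ℝ → ℝ) (hχ₁'_smooth : ContDiff ℝ (⊤ : ℕ∞) χ₁') (hχ₁'0 : χ₁' (0, 0) = 0)
    (p' : ℝ × (Fin p₁ → ℝ) × ℝ × (Fin d → ℝ) → (Fin p₂ → ℝ))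
    (hp'_smooth : ContDiff ℝ (⊤ : ℕ∞) p') (hp'0 : ∀ μ ∈ K, p' (0, 0, 0, μ) = 0)
    (f' : ℝ × (Fin p₁ → ℝ) × ℝ × (Fin d → ℝ) → ℝ)
    (hf'_smooth : ContDiff ℝ (⊤ : ℕ∞) f') (hf'0 : ∀ μ ∈ K, f' (0, 0, 0, μ) = 0)
    (χ₂' : ℝ × (Fin p₁ → ℝ) × (Fin p₂ → ℝ) × ℝ × (Fin d → ℝ) → ℝ)
    (hχ₂'_smooth : ContDiff ℝ (⊤ : ℕ∞) χ₂') (hχ₂'0 : ∀ μ ∈ K, χ₂' (0, 0, 0, 0, μ) = 0)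
    (b' : (Fin d → ℝ) → ℝ) (hb'_cont : Continuous b')
    (bstar : ℝ) (hbstar : 0 < bstar) (hb' : ∀ μ ∈ K, bstar ≤ b' μ) :
    ∃ (ρ : ℝ → ℝ), ContDiff ℝ (⊤ : ℕ∞) ρ ∧ (∀ s, 0 < ρ s) ∧
    ∃ (k : ℝ → ℝ), ContDiff ℝ (⊤ : ℕ∞) k ∧ (∀ s, 1 ≤ k s) ∧
    ∃ kstar : ℝ, 1 ≤ kstar ∧
    ∀ k₀ : ℝ, kstar ≤ k₀ →
      -- strict Lyapunov function for the closed loop with ū = −k₀ k(ζ)ζ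
      (∃ (V : (Fin p₁ → ℝ) × ℝ × (Fin p₂ → ℝ) × ℝ → ℝ), ContDiff ℝ 1 V ∧
        ∃ (α₀ α₁ : ℝ → ℝ), IsClassKInfty α₀ ∧ IsClassKInfty α₁ ∧
          (∀ z : (Fin p₁ → ℝ) × ℝ × (Fin p₂ → ℝ) × ℝ, α₀ ‖z‖ ≤ V z ∧ V z ≤ α₁ ‖z‖) ∧
          ∀ (η₁ : Fin p₁ → ℝ) (x₁ : ℝ) (η₂ : Fin p₂ → ℝ) (ζ : ℝ), ∀ μ ∈ K,
            fderiv ℝ V (η₁, x₁, η₂, ζ)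
                (M₁.mulVec η₁ + x₁ • M₁.mulVec N₁,
                 ζ - ρ x₁ * x₁ + χ₁' (η₁, x₁),
                 M₂.mulVec η₂ + p' (x₁, η₁, ζ, μ),
                 f' (x₁, η₁, ζ, μ) + b' μ * χ₂' (x₁, η₁, η₂, ζ, μ)
                   + b' μ * (-(k₀ * k ζ * ζ)))
              ≤ -‖η₁‖ ^ 2 - ‖η₂‖ ^ 2 - x₁ ^ 2 - ζ ^ 2) ∧
      -- consequence on solutions: global existence from every initial condition, and
      -- every global solution is bounded and converges to the origin
      (∀ μ : ℝ → (Fin d → ℝ), Continuous μ → (∀ t, μ t ∈ K) →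
        (∀ (η₁0 : Fin p₁ → ℝ) (x₁0 : ℝ) (η₂0 : Fin p₂ → ℝ) (ζ0 : ℝ),
          ∃ (η₁ : ℝ → (Fin p₁ → ℝ)) (x₁ : ℝ → ℝ) (η₂ : ℝ → (Fin p₂ → ℝ)) (ζ : ℝ → ℝ),
            η₁ 0 = η₁0 ∧ x₁ 0 = x₁0 ∧ η₂ 0 = η₂0 ∧ ζ 0 = ζ0 ∧
            (∀ t ∈ Set.Ici (0 : ℝ),
              HasDerivAt η₁ (M₁.mulVec (η₁ t) + x₁ t • M₁.mulVec N₁) t ∧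
              HasDerivAt x₁ (ζ t - ρ (x₁ t) * x₁ t + χ₁' (η₁ t, x₁ t)) t ∧
              HasDerivAt η₂ (M₂.mulVec (η₂ t) + p' (x₁ t, η₁ t, ζ t, μ t)) t ∧
              HasDerivAt ζ (f' (x₁ t, η₁ t, ζ t, μ t)
                + b' (μ t) * χ₂' (x₁ t, η₁ t, η₂ t, ζ t, μ t)
                + b' (μ t) * (-(k₀ * k (ζ t) * ζ t))) t)) ∧
        (∀ (η₁ : ℝ → (Fin p₁ → ℝ)) (x₁ : ℝ → ℝ) (η₂ : ℝ → (Fin p₂ → ℝ)) (ζ : ℝ → ℝ),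
          (∀ t ∈ Set.Ici (0 : ℝ),
            HasDerivAt η₁ (M₁.mulVec (η₁ t) + x₁ t • M₁.mulVec N₁) t ∧
            HasDerivAt x₁ (ζ t - ρ (x₁ t) * x₁ t + χ₁' (η₁ t, x₁ t)) t ∧
            HasDerivAt η₂ (M₂.mulVec (η₂ t) + p' (x₁ t, η₁ t, ζ t, μ t)) t ∧
            HasDerivAt ζ (f' (x₁ t, η₁ t, ζ t, μ t)
              + b' (μ t) * χ₂' (x₁ t, η₁ t, η₂ t, ζ t, μ t)
              + b' (μ t) * (-(k₀ * k (ζ t) * ζ t))) t) →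
          (∃ c : ℝ, ∀ t ∈ Set.Ici (0 : ℝ), ‖(η₁ t, x₁ t, η₂ t, ζ t)‖ ≤ c) ∧
          Tendsto (fun t => (η₁ t, x₁ t, η₂ t, ζ t)) atTop
            (nhds (0 : (Fin p₁ → ℝ) × ℝ × (Fin p₂ → ℝ) × ℝ)))) := by
  have hp'₁ : ContDiff ℝ 1 p' := hp'_smooth.of_le (by norm_cast)
  have hf'₁ : ContDiff ℝ 1 f' := hf'_smooth.of_le (by norm_cast)
  have hχ₁'₁ : ContDiff ℝ 1 χ₁' := hχ₁'_smooth.of_le (by norm_cast)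
  have hχ₂'₁ : ContDiff ℝ 1 χ₂' := hχ₂'_smooth.of_le (by norm_cast)
  obtain ⟨g, hg, hgχ⟩ := exists_isGain_norm_le (P := ℝ) (K := {0})
    (F := fun y : ((Fin p₁ → ℝ) × ℝ) × ℝ => χ₁' y.1)
    (by fun_prop) isCompact_singleton fun _ _ => hχ₁'0
  obtain ⟨l, hl, hlp⟩ := exists_isGain_norm_le
    (F := fun y : (ℝ × (Fin p₁ → ℝ) × ℝ) × (Fin d → ℝ) => p' (y.1.1, y.1.2.1, y.1.2.2, y.2))
    (by fun_prop) hK hp'0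
  obtain ⟨Lf, hLf, hLf'⟩ := exists_isGain_norm_le
    (F := fun y : ((Fin p₁ → ℝ) × ℝ × (Fin p₂ → ℝ) × ℝ) × (Fin d → ℝ) =>
      f' (y.1.2.1, y.1.1, y.1.2.2.2, y.2)) (by fun_prop) hK hf'0
  obtain ⟨Lχ, hLχ, hLχ'⟩ := exists_isGain_norm_le
    (F := fun y : ((Fin p₁ → ℝ) × ℝ × (Fin p₂ → ℝ) × ℝ) × (Fin d → ℝ) =>
      χ₂' (y.1.2.1, y.1.1, y.1.2.2.1, y.1.2.2.2, y.2)) (by fun_prop) hK hχ₂'0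
  obtain ⟨β, hβ⟩ := (hK.image hb'_cont.norm).bddAbove
  obtain ⟨ρ, hρ, hρ₀, k, hk, hk₁, V, hV, α₀, α₁, hα₀, hα₁, hVα, hVd⟩ :=
    exists_cascade_lyapunov hM₁ hM₂ (M₁ *ᵥ N₁) hg hl (hLf.add (hLχ.const_mul (abs_nonneg β)))
  refine ⟨ρ, hρ, hρ₀, k, hk, hk₁, max 1 (1 / bstar), le_max_left _ _, fun k₀ hk₀ => ?_⟩
  have hdecay : ∀ (η₁ : Fin p₁ → ℝ) (x₁ : ℝ) (η₂ : Fin p₂ → ℝ) (ζ : ℝ), ∀ μ ∈ K,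
      fderiv ℝ V (η₁, x₁, η₂, ζ)
          (M₁ *ᵥ η₁ + x₁ • M₁ *ᵥ N₁, ζ - ρ x₁ * x₁ + χ₁' (η₁, x₁), M₂ *ᵥ η₂ + p' (x₁, η₁, ζ, μ),
            f' (x₁, η₁, ζ, μ) + b' μ * χ₂' (x₁, η₁, η₂, ζ, μ) + b' μ * (-(k₀ * k ζ * ζ))) ≤
        -‖η₁‖ ^ 2 - ‖η₂‖ ^ 2 - x₁ ^ 2 - ζ ^ 2 := by
    intro η₁ x₁ η₂ ζ μ hμ
    have hκ : 1 ≤ b' μ * k₀ := calc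
      1 = bstar * (1 / bstar) := (mul_one_div_cancel hbstar.ne').symm
      _ ≤ b' μ * k₀ := mul_le_mul (hb' μ hμ) ((le_max_right _ _).trans hk₀) (by positivity)
        (hbstar.le.trans (hb' μ hμ))
    have hφ : ‖f' (x₁, η₁, ζ, μ) + b' μ * χ₂' (x₁, η₁, η₂, ζ, μ)‖ ≤
        (Lf ‖(η₁, x₁, η₂, ζ)‖ + |β| * Lχ ‖(η₁, x₁, η₂, ζ)‖) * ‖(η₁, x₁, η₂, ζ)‖ := by
      refine (norm_add_le _ _).trans ?_
      rw [norm_mul, add_mul, mul_assoc]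
      exact add_le_add (hLf' (η₁, x₁, η₂, ζ) μ hμ)
        (mul_le_mul ((hβ ⟨μ, hμ, rfl⟩).trans (le_abs_self β)) (hLχ' (η₁, x₁, η₂, ζ) μ hμ)
          (norm_nonneg _) (abs_nonneg β))
    have := hVd η₁ x₁ η₂ ζ _ _ _ _ (hgχ (η₁, x₁) 0 rfl) (hlp (x₁, η₁, ζ) μ hμ) hφ hκ
    convert this using 5
    ring
  refine ⟨⟨V, hV, α₀, α₁, hα₀, hα₁, hVα, hdecay⟩, fun μ hμ hμK => ⟨?_, ?_⟩⟩
  · intro η₁0 x₁0 η₂0 ζ0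
    have hρ₁ : ContDiff ℝ 1 ρ := hρ.of_le (by norm_cast)
    have hkc : ContDiff ℝ 1 k := hk.of_le (by norm_cast)
    let A (y : ((Fin p₁ → ℝ) × ℝ × (Fin p₂ → ℝ) × ℝ) × (Fin d → ℝ)) :
        (Fin p₁ → ℝ) × ℝ × (Fin p₂ → ℝ) × ℝ :=
      (M₁ *ᵥ y.1.1 + y.1.2.1 • M₁ *ᵥ N₁,
        y.1.2.2.2 - ρ y.1.2.1 * y.1.2.1 + χ₁' (y.1.1, y.1.2.1),
        M₂ *ᵥ y.1.2.2.1 + p' (y.1.2.1, y.1.1, y.1.2.2.2, y.2),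
        f' (y.1.2.1, y.1.1, y.1.2.2.2, y.2))
    let D (y : ((Fin p₁ → ℝ) × ℝ × (Fin p₂ → ℝ) × ℝ) × (Fin d → ℝ)) :
        (Fin p₁ → ℝ) × ℝ × (Fin p₂ → ℝ) × ℝ :=
      (0, 0, 0, χ₂' (y.1.2.1, y.1.1, y.1.2.2.1, y.1.2.2.2, y.2) +
        -(k₀ * k y.1.2.2.2 * y.1.2.2.2))
    have hA : ContDiff ℝ 1 A := by
      have h₁ : ContDiff ℝ 1 fun v => M₁ *ᵥ v := M₁.mulVecLin.toContinuousLinearMap.contDiff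
      have h₂ : ContDiff ℝ 1 fun v => M₂ *ᵥ v := M₂.mulVecLin.toContinuousLinearMap.contDiff
      fun_prop
    have hD : ContDiff ℝ 1 D := by fun_prop
    have hfield (z : (Fin p₁ → ℝ) × ℝ × (Fin p₂ → ℝ) × ℝ) (ν : Fin d → ℝ) :
        A (z, ν) + b' ν • D (z, ν) =
          (M₁ *ᵥ z.1 + z.2.1 • M₁ *ᵥ N₁, z.2.2.2 - ρ z.2.1 * z.2.1 + χ₁' (z.1, z.2.1),
            M₂ *ᵥ z.2.2.1 + p' (z.2.1, z.1, z.2.2.2, ν),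
            f' (z.2.1, z.1, z.2.2.2, ν) + b' ν * χ₂' (z.2.1, z.1, z.2.2.1, z.2.2.2, ν) +
              b' ν * (-(k₀ * k z.2.2.2 * z.2.2.2))) := by
      simp [A, D, mul_add, add_assoc]
    obtain ⟨u, hu0, hu⟩ := exists_forward_solution_of_lyapunov hA hD hb'_cont hK
      (hV.differentiable one_ne_zero)
      (fun m => (hα₀.exists_le_of_le m).imp fun c hc z hz => hc _ ((hVα z).1.trans hz))
      (fun ⟨η₁, x₁, η₂, ζ⟩ ν hν => by
        have h := hdecay η₁ x₁ η₂ ζ ν hν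
        rw [hfield]
        refine h.trans ?_
        linarith [sq_nonneg ‖η₁‖, sq_nonneg ‖η₂‖, sq_nonneg x₁, sq_nonneg ζ])
      hμ hμK (η₁0, x₁0, η₂0, ζ0)
    refine ⟨fun t => (u t).1, fun t => (u t).2.1, fun t => (u t).2.2.1, fun t => (u t).2.2.2,
      by simp [hu0], by simp [hu0], by simp [hu0], by simp [hu0], fun t ht => ?_⟩
    have h := hu t ht
    rw [hfield] at h
    obtain ⟨d₁, h⟩ := hasDerivAt_prod_components h
    obtain ⟨d₂, h⟩ := hasDerivAt_prod_components h
    obtain ⟨d₃, d₄⟩ := hasDerivAt_prod_components h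
    exact ⟨d₁, d₂, d₃, d₄⟩
  · intro η₁ x₁ η₂ ζ h
    refine bounded_and_tendsto_zero_of_lyapunov (hV.differentiable one_ne_zero) hα₀ hα₁ hVα
      (fun t ht => (h t ht).1.prodMk
        ((h t ht).2.1.prodMk ((h t ht).2.2.1.prodMk (h t ht).2.2.2)))
      fun t _ => (hdecay _ _ _ _ _ (hμK t)).trans ?_
    have e₁ := sq_norm_prod_le_add (η₁ t) (x₁ t, η₂ t, ζ t)
    have e₂ := sq_norm_prod_le_add (x₁ t) (η₂ t, ζ t)
    have e₃ := sq_norm_prod_le_add (η₂ t) (ζ t)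
    rw [Real.norm_eq_abs, sq_abs] at e₂ e₃
    linarith
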